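/- arXiv:2502.06885 — 3 statements merged into one kernel-verified Lean document; each statement's English description precedes it below -/
import Mathlib

section
/- Let x ∈ ℝ^{n₀} be a fixed network input, let A : ℝ^{q₁} × ℝ^{n₀} → ℝ^n and B : ℝ^{q₂} × ℝ^n → ℝ be differentiable maps (the parameterized subnetwork before the insertion point and the parameterized subnetwork after the insertion point composed with the loss, respectively), and let g : ℝ^n × ℝ^p → ℝ^n be differentiable and satisfy, for every y ∈ ℝ^n: g(y,0) = 0, the Fréchet derivative of g with respect to its first argument at (y,0) is zero, and the Fréchet derivative of g with respect to its second argument at (y,0) is zero. Define the original loss J₀(ψ₁,ψ₂) := B(ψ₂, A(ψ₁,x)) and the perturbed loss (with an inserted residual layer y ↦ y + g(y,θ)) J(ψ₁,ψ₂,θ) := B(ψ₂, A(ψ₁,x) + g(A(ψ₁,x), θ)). Then: (i) J(ψ₁,ψ₂,0) = J₀(ψ₁,ψ₂) for all (ψ₁,ψ₂); (ii) the Fréchet derivatives of J with respect to ψ₁ and with respect to ψ₂ at θ = 0 coincide with the corresponding Fréchet derivatives of J₀; and (iii) the Fréchet derivative of J with respect to θ at θ = 0 is zero. Hence the inserted layer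 with zero parameters acts as a message-passing layer: it leaves the loss, the gradients with respect to all pre-existing parameters, and the gradient-descent update of the new parameters unchanged. -/
/-- Proposition 2.3 (construction of an admissible perturbation): inserting a residual
layer `y ↦ y + g (y, θ)` with `g (y, 0) = 0` and vanishing Fréchet derivatives in both
arguments at `(y, 0)` leaves, at `θ = 0`, the loss, the gradients with respect to the
pre-existing parameters, and the gradient of the new parameters (which is zero)
unchanged. -/
theorem admissible_perturbation_message_passing
    {q₁ q₂ n₀ n p : ℕ}
    (x : EuclideanSpace ℝ (Fin n₀))
    (A : EuclideanSpace ℝ (Fin q₁) × EuclideanSpace ℝ (Fin n₀) → EuclideanSpace ℝ (Fin n))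
    (B : EuclideanSpace ℝ (Fin q₂) × EuclideanSpace ℝ (Fin n) → ℝ)
    (g : EuclideanSpace ℝ (Fin n) × EuclideanSpace ℝ (Fin p) → EuclideanSpace ℝ (Fin n))
    (hA : Differentiable ℝ A) (hB : Differentiable ℝ B) (hg : Differentiable ℝ g)
    (hg0 : ∀ y : EuclideanSpace ℝ (Fin n), g (y, 0) = 0)
    (hgy : ∀ y : EuclideanSpace ℝ (Fin n),
      fderiv ℝ (fun z : EuclideanSpace ℝ (Fin n) =>
        g (z, (0 : EuclideanSpace ℝ (Fin p)))) y = 0)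
    (hgθ : ∀ y : EuclideanSpace ℝ (Fin n),
      fderiv ℝ (fun θ : EuclideanSpace ℝ (Fin p) => g (y, θ)) 0 = 0)
    (J₀ : EuclideanSpace ℝ (Fin q₁) → EuclideanSpace ℝ (Fin q₂) → ℝ)
    (hJ₀ : J₀ = fun ψ₁ ψ₂ => B (ψ₂, A (ψ₁, x)))
    (J : EuclideanSpace ℝ (Fin q₁) → EuclideanSpace ℝ (Fin q₂) →
      EuclideanSpace ℝ (Fin p) → ℝ)
    (hJ : J = fun ψ₁ ψ₂ θ => B (ψ₂, A (ψ₁, x) + g (A (ψ₁, x), θ))) :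
    -- (i) the loss is unchanged at θ = 0
    (∀ ψ₁ ψ₂, J ψ₁ ψ₂ 0 = J₀ ψ₁ ψ₂) ∧
    -- (ii) the gradients with respect to the pre-existing parameters are unchanged
    (∀ ψ₁ ψ₂, fderiv ℝ (fun ψ => J ψ ψ₂ 0) ψ₁ = fderiv ℝ (fun ψ => J₀ ψ ψ₂) ψ₁) ∧
    (∀ ψ₁ ψ₂, fderiv ℝ (fun ψ => J ψ₁ ψ 0) ψ₂ = fderiv ℝ (fun ψ => J₀ ψ₁ ψ) ψ₂) ∧
    -- (iii) the gradient with respect to the new parameters vanishes at θ = 0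
    (∀ ψ₁ ψ₂, fderiv ℝ (fun θ => J ψ₁ ψ₂ θ) 0 = 0) := by
  subst hJ₀ hJ
  refine ⟨fun ψ₁ ψ₂ => by simp [hg0], fun ψ₁ ψ₂ => by simp [hg0],
    fun ψ₁ ψ₂ => by simp [hg0], fun ψ₁ ψ₂ => ?_⟩
  have h1 : HasFDerivAt (fun θ : EuclideanSpace ℝ (Fin p) => g (A (ψ₁, x), θ))
      (0 : EuclideanSpace ℝ (Fin p) →L[ℝ] EuclideanSpace ℝ (Fin n)) 0 := by
    rw [← hgθ (A (ψ₁, x))]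
    have hd : Differentiable ℝ
        (fun θ : EuclideanSpace ℝ (Fin p) => g (A (ψ₁, x), θ)) := by fun_prop
    exact (hd 0).hasFDerivAt
  have h2 := (hasFDerivAt_const ψ₂ (0 : EuclideanSpace ℝ (Fin p))).prodMk
    (h1.const_add (A (ψ₁, x)))
  have h3 := ((hB _).hasFDerivAt).comp (0 : EuclideanSpace ℝ (Fin p)) h2
  refine h3.fderiv.trans ?_
  ext v
  exact map_zero (fderiv ℝ B (ψ₂, A (ψ₁, x) + g (A (ψ₁, x), 0)))
end

section
/- Existence of the network topological derivative (Theorem 2.7): assume each B_s is twice continuously differentiable and, for each s, the map θ ↦ g(x_s,θ) is twice continuously differentiable. Then for every φ ∈ ℝ^p the one-sided limit −lim_{ε→0⁺} (𝒥(εφ) − 𝒥(0))/ε² exists, i.e. the topological asymptotic expansion 𝒥(εφ) = 𝒥(0) − ε² d𝒥 + o(ε²) holds with q(ε) = ε², and the network topological derivative is given in closed form by d𝒥 = (1/2) Σ_{s=1}^S ⟨φ, ∇²_θ H_s(0) φ⟩, the Hessian quadratic form of the inserted layer's Hamiltonian at zero parameters. -/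
open scoped RealInnerProductSpace Topology
open Filter

theorem aux_second_order {E F : Type*} [NormedAddCommGroup E] [NormedSpace ℝ E]
    [NormedAddCommGroup F] [NormedSpace ℝ F] {f : E → F} (hf : ContDiff ℝ 2 f)
    (h1 : fderiv ℝ f 0 = 0) (φ : E) :
    Tendsto (fun ε : ℝ => (ε ^ 2)⁻¹ • (f (ε • φ) - f 0)) (𝓝[>] 0)
      (𝓝 ((1 / 2 : ℝ) • fderiv ℝ (fderiv ℝ f) 0 φ φ)) := by
  have hk : ContDiff ℝ 2 (fun t : ℝ => f (t • φ)) := by fun_prop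
  have hline : ∀ t : ℝ, HasDerivAt (fun t : ℝ => t • φ) φ t := fun t => by
    simpa using (hasDerivAt_id t).smul_const φ
  have hd1 : deriv (fun t : ℝ => f (t • φ)) = fun t => fderiv ℝ f (t • φ) φ := by
    funext t
    exact (((hf.differentiable (by norm_num)) (t • φ)).hasFDerivAt.comp_hasDerivAt t
      (hline t)).deriv
  have hf' : Differentiable ℝ (fderiv ℝ f) :=
    (hf.fderiv_right (m := 1) (by norm_num)).differentiable (by norm_num)
  have hd2 : deriv (fun t : ℝ => fderiv ℝ f (t • φ) φ) 0 = fderiv ℝ (fderiv ℝ f) 0 φ φ := by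
    have h := (hf' ((0 : ℝ) • φ)).hasFDerivAt.comp_hasDerivAt (0 : ℝ) (hline 0)
    have h2 := h.clm_apply (hasDerivAt_const (0 : ℝ) φ)
    simpa using h2.deriv
  have ht := taylor_isLittleO_univ (x₀ := 0) (n := 2) hk
  have ht2 := (ht.mono (nhdsWithin_le_nhds (s := Set.Ioi 0))).tendsto_inv_smul_nhds_zero
  have ht3 := ht2.add_const ((1 / 2 : ℝ) • fderiv ℝ (fderiv ℝ f) 0 φ φ)
  rw [zero_add] at ht3
  refine ht3.congr' ?_
  filter_upwards [self_mem_nhdsWithin] with ε hε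
  have hε0 : ε ≠ 0 := ne_of_gt hε
  have e : taylorWithinEval (fun t : ℝ => f (t • φ)) 2 Set.univ 0 ε
      = f 0 + (1 / 2 * ε ^ 2 : ℝ) • fderiv ℝ (fderiv ℝ f) 0 φ φ := by
    rw [taylorWithinEval_succ, taylorWithinEval_succ, taylor_within_zero_eval]
    simp only [iteratedDerivWithin_univ]
    have i2 : iteratedDeriv (0 + 1 + 1) (fun t : ℝ => f (t • φ)) 0
        = fderiv ℝ (fderiv ℝ f) 0 φ φ := by
      rw [iteratedDeriv_succ, iteratedDeriv_one, hd1, hd2]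
    have i1 : iteratedDeriv (0 + 1) (fun t : ℝ => f (t • φ)) 0 = 0 := by
      rw [zero_add, iteratedDeriv_one, hd1]
      simp [h1]
    rw [i1]
    erw [i2]
    norm_num
  rw [e]
  simp only [sub_zero, smul_sub, smul_add, smul_smul]
  have : (ε ^ 2)⁻¹ * (1 / 2 * ε ^ 2) = 1 / 2 := by field_simp
  rw [this]
  abel

/-- Theorem 2.7 (existence of the network topological derivative): under `C²` regularity
of the post-insertion map `B s` and of the inserted layer `θ ↦ g (x s) θ` (which is an
admissible perturbation: `g x 0 = 0` and zero Fréchet derivative in `θ` at `0`), for every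
direction `φ` the one-sided limit `-lim_{ε→0⁺} (𝒥(εφ) - 𝒥(0))/ε²` exists and equals
`(1/2) ∑ s, ⟨φ, ∇²_θ H_s(0) φ⟩`. -/
theorem network_topological_derivative_exists
    {S n p : ℕ} (hS : 0 < S)
    (x : Fin S → EuclideanSpace ℝ (Fin n))
    (B : Fin S → EuclideanSpace ℝ (Fin n) → ℝ)
    (hB : ∀ s, ContDiff ℝ 2 (B s))
    (g : EuclideanSpace ℝ (Fin n) → EuclideanSpace ℝ (Fin p) → EuclideanSpace ℝ (Fin n))
    (hg : ∀ s, ContDiff ℝ 2 (g (x s)))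
    (hg0 : ∀ y, g y 0 = 0)
    (hg1 : ∀ y, fderiv ℝ (g y) 0 = 0)
    (J : EuclideanSpace ℝ (Fin p) → ℝ)
    (hJ : J = fun θ => (1 / (S : ℝ)) * ∑ s, B s (x s + g (x s) θ))
    (padj : Fin S → EuclideanSpace ℝ (Fin n))
    (hpadj : padj = fun s => -((1 / (S : ℝ)) • gradient (B s) (x s)))
    (H : Fin S → EuclideanSpace ℝ (Fin p) → ℝ)
    (hH : H = fun s θ => ⟪padj s, x s + g (x s) θ⟫)
    (φ : EuclideanSpace ℝ (Fin p)) :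
    Tendsto (fun ε : ℝ => -((J (ε • φ) - J 0) / ε ^ 2)) (𝓝[>] 0)
      (𝓝 ((1 / 2 : ℝ) * ∑ s, fderiv ℝ (fderiv ℝ (H s)) 0 φ φ)) := by
  have hF : ∀ s, Tendsto (fun ε : ℝ => (ε ^ 2)⁻¹ • (B s (x s + g (x s) (ε • φ)) - B s (x s)))
      (𝓝[>] 0) (𝓝 (fderiv ℝ (B s) (x s)
        ((1 / 2 : ℝ) • fderiv ℝ (fderiv ℝ (g (x s))) 0 φ φ))) := by
    intro s
    have h := aux_second_order (hg s) (hg1 (x s)) φ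
    simp only [hg0, sub_zero] at h
    have hgt : Tendsto (fun ε : ℝ => g (x s) (ε • φ)) (𝓝[>] 0) (𝓝 0) := by
      have hcont : Continuous (fun ε : ℝ => g (x s) (ε • φ)) := by
        have := (hg s).continuous
        fun_prop
      have := hcont.tendsto 0
      simp only [zero_smul, hg0] at this
      exact this.mono_left nhdsWithin_le_nhds
    exact (((hB s).differentiable (by norm_num)) (x s)).hasFDerivAt.hasFDerivWithinAt.lim
      (s := Set.univ) hgt (Eventually.of_forall fun _ => Set.mem_univ _) h
  have hHs : ∀ s, Tendsto (fun ε : ℝ => -((1 / (S : ℝ)) *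
      ((ε ^ 2)⁻¹ • (B s (x s + g (x s) (ε • φ)) - B s (x s))))) (𝓝[>] 0)
      (𝓝 ((1 / 2 : ℝ) * fderiv ℝ (fderiv ℝ (H s)) 0 φ φ)) := by
    intro s
    have hHC : ContDiff ℝ 2 (H s) := by
      have := hg s
      rw [hH]
      exact contDiff_const.inner ℝ (contDiff_const.add this)
    have hgd : HasFDerivAt (𝕜 := ℝ) (g (x s)) 0 0 := by
      have := (((hg s).differentiable (by norm_num)) 0).hasFDerivAt
      rwa [hg1] at this
    have hin : ∀ v, ⟪padj s, v⟫ = -((1 / (S : ℝ)) * fderiv ℝ (B s) (x s) v) := by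
      intro v
      simp [hpadj, inner_neg_left, inner_smul_left, gradient]
    have hH1 : fderiv ℝ (H s) 0 = 0 := by
      have h := ((innerSL ℝ (padj s)).hasFDerivAt).comp (0 : EuclideanSpace ℝ (Fin p))
        (hgd.const_add (x s))
      have h' : HasFDerivAt (H s) ((innerSL ℝ (padj s)).comp
          (0 : EuclideanSpace ℝ (Fin p) →L[ℝ] EuclideanSpace ℝ (Fin n))) 0 := by
        rw [hH]; exact h
      rw [h'.fderiv]; simp
    have hA := aux_second_order hHC hH1 φ
    have hB' : Tendsto (fun ε : ℝ => (ε ^ 2)⁻¹ • (H s (ε • φ) - H s 0)) (𝓝[>] 0)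
        (𝓝 ⟪padj s, (1 / 2 : ℝ) • fderiv ℝ (fderiv ℝ (g (x s))) 0 φ φ⟫) := by
      have h := aux_second_order (hg s) (hg1 (x s)) φ
      have h2 := ((innerSL ℝ (padj s)).continuous.tendsto _).comp h
      refine h2.congr fun ε => ?_
      simp [hH, hg0, inner_add_right, inner_smul_right]
    have hu := tendsto_nhds_unique hA hB'
    rw [smul_eq_mul, hin] at hu
    rw [hu]
    exact ((hF s).const_mul _).neg
  rw [Finset.mul_sum]
  refine (tendsto_finsetSum Finset.univ fun s _ => hHs s).congr fun ε => ?_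
  rw [hJ]
  simp only [hg0, add_zero, smul_eq_mul, Finset.sum_neg_distrib, ← Finset.mul_sum,
    Finset.sum_sub_distrib]
  ring
end

section
/- Hessian identity for the perturbed loss (Corollary 2.8, second and third bullets): assume each B_s is twice continuously differentiable and, for each s, the map θ ↦ g(x_s,θ) is twice continuously differentiable. Then for every direction φ ∈ ℝ^p the second derivative of ε ↦ 𝒥(εφ) at ε = 0 equals the Hessian quadratic form ⟨φ, ∇²𝒥(0) φ⟩, and moreover ⟨φ, ∇²𝒥(0) φ⟩ = − Σ_{s=1}^S ⟨φ, ∇²_θ H_s(0) φ⟩; that is, the network topological derivative equals minus one half of the Hessian of the loss at zero parameters of the added layer acting on φ on both sides. -/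
open scoped RealInnerProductSpace Topology
open Filter

theorem aux_comp {E F : Type*} [NormedAddCommGroup E] [NormedSpace ℝ E]
    [NormedAddCommGroup F] [NormedSpace ℝ F]
    (b : F → ℝ) (hb : ContDiff ℝ 2 b) (G : E → F) (hG : ContDiff ℝ 2 G) (x0 : F)
    (h0 : G 0 = 0) (h1 : fderiv ℝ G 0 = 0) (φ : E) :
    fderiv ℝ (fderiv ℝ (fun θ => b (x0 + G θ))) 0 φ φ
      = fderiv ℝ b x0 (fderiv ℝ (fderiv ℝ G) 0 φ φ) := by
  have hbd : Differentiable ℝ b := hb.differentiable (by norm_num)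
  have hGd : Differentiable ℝ G := hG.differentiable (by norm_num)
  have hb' : Differentiable ℝ (fderiv ℝ b) :=
    (hb.fderiv_right (m := 1) (by norm_num)).differentiable (by norm_num)
  have hG' : Differentiable ℝ (fderiv ℝ G) :=
    (hG.fderiv_right (m := 1) (by norm_num)).differentiable (by norm_num)
  have e : fderiv ℝ (fun θ => b (x0 + G θ))
      = fun θ => (fderiv ℝ b (x0 + G θ)).comp (fderiv ℝ G θ) := by
    funext θ
    exact ((hbd _).hasFDerivAt.comp θ ((hGd θ).hasFDerivAt.const_add x0)).fderiv
  have hc : DifferentiableAt ℝ (fun θ => fderiv ℝ b (x0 + G θ)) 0 :=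
    (hb' _).comp (0 : E) ((hGd 0).const_add x0)
  rw [e, (hc.hasFDerivAt.clm_comp (hG' 0).hasFDerivAt).fderiv]
  simp [h0, h1]

theorem aux_line {E : Type*} [NormedAddCommGroup E] [NormedSpace ℝ E]
    (J : E → ℝ) (hJ : ContDiff ℝ 2 J) (φ : E) :
    deriv (deriv (fun ε : ℝ => J (ε • φ))) 0 = fderiv ℝ (fderiv ℝ J) 0 φ φ := by
  have hd : Differentiable ℝ J := hJ.differentiable (by norm_num)
  have hd' : Differentiable ℝ (fderiv ℝ J) :=
    (hJ.fderiv_right (m := 1) (by norm_num)).differentiable (by norm_num)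
  have hl : ∀ t : ℝ, HasDerivAt (fun ε : ℝ => ε • φ) φ t := fun t => by
    simpa using (hasDerivAt_id t).smul_const φ
  have e : deriv (fun ε : ℝ => J (ε • φ)) = fun ε => fderiv ℝ J (ε • φ) φ := by
    funext t
    exact ((hd _).hasFDerivAt.comp_hasDerivAt t (hl t)).deriv
  rw [e]
  have hc : HasDerivAt (fun ε : ℝ => fderiv ℝ J (ε • φ)) (fderiv ℝ (fderiv ℝ J) 0 φ) 0 := by
    have h := (hd' ((0 : ℝ) • φ)).hasFDerivAt.comp_hasDerivAt (0 : ℝ) (hl 0)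
    rw [zero_smul] at h
    exact h
  have h2 : HasDerivAt (fun ε : ℝ => fderiv ℝ J (ε • φ) φ) (fderiv ℝ (fderiv ℝ J) 0 φ φ) 0 :=
    (ContinuousLinearMap.apply ℝ ℝ φ).hasFDerivAt.comp_hasDerivAt (0 : ℝ) hc
  exact h2.deriv

/-- Corollary 2.8, second and third bullets: for every direction `φ`, the second
derivative of `ε ↦ 𝒥(εφ)` at `ε = 0` equals the Hessian quadratic form `⟨φ, ∇²𝒥(0) φ⟩`,
and `⟨φ, ∇²𝒥(0) φ⟩ = -∑ s, ⟨φ, ∇²_θ H_s(0) φ⟩`; hence the network topological derivative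
is minus one half of the Hessian of the loss at zero acting on `φ` on both sides. -/
theorem hessian_identity_for_perturbed_loss
    {S n p : ℕ} (hS : 0 < S)
    (x : Fin S → EuclideanSpace ℝ (Fin n))
    (B : Fin S → EuclideanSpace ℝ (Fin n) → ℝ)
    (hB : ∀ s, ContDiff ℝ 2 (B s))
    (g : EuclideanSpace ℝ (Fin n) → EuclideanSpace ℝ (Fin p) → EuclideanSpace ℝ (Fin n))
    (hg : ∀ s, ContDiff ℝ 2 (g (x s)))
    (hg0 : ∀ y, g y 0 = 0)
    (hg1 : ∀ y, fderiv ℝ (g y) 0 = 0)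
    (J : EuclideanSpace ℝ (Fin p) → ℝ)
    (hJ : J = fun θ => (1 / (S : ℝ)) * ∑ s, B s (x s + g (x s) θ))
    (padj : Fin S → EuclideanSpace ℝ (Fin n))
    (hpadj : padj = fun s => -((1 / (S : ℝ)) • gradient (B s) (x s)))
    (H : Fin S → EuclideanSpace ℝ (Fin p) → ℝ)
    (hH : H = fun s θ => ⟪padj s, x s + g (x s) θ⟫)
    (φ : EuclideanSpace ℝ (Fin p)) :
    deriv (deriv (fun ε : ℝ => J (ε • φ))) 0 = fderiv ℝ (fderiv ℝ J) 0 φ φ ∧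
    fderiv ℝ (fderiv ℝ J) 0 φ φ = -∑ s, fderiv ℝ (fderiv ℝ (H s)) 0 φ φ := by
  have hf : ∀ s, ContDiff ℝ 2 (fun θ => B s (x s + g (x s) θ)) := fun s =>
    (hB s).comp (contDiff_const.add (hg s))
  have hJc : ContDiff ℝ 2 J := by
    rw [hJ]
    exact contDiff_const.mul (ContDiff.sum fun s _ => hf s)
  refine ⟨aux_line J hJc φ, ?_⟩
  have hfd : ∀ s, Differentiable ℝ (fun θ => B s (x s + g (x s) θ)) := fun s =>
    (hf s).differentiable (by norm_num)
  have hfd' : ∀ s, Differentiable ℝ (fderiv ℝ (fun θ => B s (x s + g (x s) θ))) := fun s =>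
    ((hf s).fderiv_right (m := 1) (by norm_num)).differentiable (by norm_num)
  have e1 : fderiv ℝ J
      = fun θ => (1 / (S : ℝ)) • ∑ s, fderiv ℝ (fun θ => B s (x s + g (x s) θ)) θ := by
    funext θ
    rw [hJ]
    exact ((HasFDerivAt.fun_sum fun s _ => (hfd s θ).hasFDerivAt).const_mul _).fderiv
  have e2 : fderiv ℝ (fderiv ℝ J) 0
      = (1 / (S : ℝ)) • ∑ s, fderiv ℝ (fderiv ℝ (fun θ => B s (x s + g (x s) θ))) 0 := by
    rw [e1]
    exact ((HasFDerivAt.fun_sum fun s _ => (hfd' s 0).hasFDerivAt).const_smul (1 / (S : ℝ))).fderiv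
  have e3 : ∀ s, fderiv ℝ (fderiv ℝ (H s)) 0 φ φ
      = -((1 / (S : ℝ)) * fderiv ℝ (B s) (x s) (fderiv ℝ (fderiv ℝ (g (x s))) 0 φ φ)) := by
    intro s
    have := aux_comp (fun y => innerSL ℝ (padj s) y) (innerSL ℝ (padj s)).contDiff
      (g (x s)) (hg s) (x s) (hg0 _) (hg1 _) φ
    rw [ContinuousLinearMap.fderiv] at this
    rw [hH]
    refine this.trans ?_
    simp [hpadj, inner_smul_left, gradient]
  rw [e2, ← Finset.sum_neg_distrib]
  simp only [e3, neg_neg, ContinuousLinearMap.smul_apply, ContinuousLinearMap.sum_apply,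
    smul_eq_mul, Finset.mul_sum]
  refine Finset.sum_congr rfl fun s _ => ?_
  rw [aux_comp (B s) (hB s) (g (x s)) (hg s) (x s) (hg0 _) (hg1 _) φ]
end
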